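/- Suppose θ₁(p) ≠ 0, θ₁(t_a) ≠ 0 and θ₁(p−t_a) ≠ 0 for all a, and θ₁(t_a−t_b) ≠ 0 for all a ≠ b. Then Tr(Φ(p)²) = Σ_{a} κ_a² + Σ_{a≠b} C_{ab}·C_{ba}·℘(t_a−t_b) − (Σ_{a≠b} C_{ab}·C_{ba})·℘(p). -/

import Mathlib

/-- The Jacobi theta function `θ₁(z|τ)`, defined from the two-variable Jacobi theta
function: `θ₁(z) = -i · exp(iπτ/4 + iπz) · Θ₂(z + (1+τ)/2)`. -/
noncomputable def theta1 (τ z : ℂ) : ℂ :=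
  -Complex.I * Complex.exp (Real.pi * Complex.I * τ / 4 + Real.pi * Complex.I * z) *
    jacobiTheta₂ (z + (1 + τ) / 2) τ

/-- The second logarithmic derivative `℘(z) = (θ₁''(z)θ₁(z) - θ₁'(z)²)/θ₁(z)²`. -/
noncomputable def wp (τ z : ℂ) : ℂ :=
  (deriv (deriv (theta1 τ)) z * theta1 τ z - (deriv (theta1 τ) z) ^ 2) / (theta1 τ z) ^ 2

/-- The diagonal matrix `Θ(p) = diag(θ₁(p-t_a)/θ₁(t_a))`. -/
noncomputable def ThetaDiag (τ : ℂ) (n : ℕ) (t : Fin n → ℂ) (p : ℂ) :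
    Matrix (Fin n) (Fin n) ℂ :=
  Matrix.diagonal fun a => theta1 τ (p - t a) / theta1 τ (t a)

/-- The diagonal-free matrix `F(p)` with off-diagonal entries
`F_{ab}(p) = C_{ab} θ₁(p+t_a-t_b) θ₁'(0) / (θ₁(t_b-t_a) θ₁(p))`. -/
noncomputable def FMat (τ : ℂ) (n : ℕ) (t : Fin n → ℂ) (C : Matrix (Fin n) (Fin n) ℂ)
    (p : ℂ) : Matrix (Fin n) (Fin n) ℂ :=
  Matrix.of fun a b =>
    if a = b then 0 else
      C a b * theta1 τ (p + t a - t b) * deriv (theta1 τ) 0 /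
        (theta1 τ (t b - t a) * theta1 τ p)

/-- The elliptic framed Higgs field `Φ(p) = H⁻¹ (K + Θ(p) F(p) Θ(p)⁻¹) H`. -/
noncomputable def PhiEll (τ : ℂ) (n : ℕ) (κ t : Fin n → ℂ)
    (C H : Matrix (Fin n) (Fin n) ℂ) (p : ℂ) : Matrix (Fin n) (Fin n) ℂ :=
  H⁻¹ * (Matrix.diagonal κ + ThetaDiag τ n t p * FMat τ n t C p * (ThetaDiag τ n t p)⁻¹) * H

/-- The even-index half `∑ k, exp (2πiτk² + 4πikz)` of the theta series in the addition formula. -/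
noncomputable def thetaEven (τ z : ℂ) : ℂ := jacobiTheta₂ (2 * z) (2 * τ)

/-- The odd-index half `∑ k, exp (iπτ(2k+1)²/2 + 2πi(2k+1)z)` of the theta series in the
addition formula. -/
noncomputable def thetaOdd (τ z : ℂ) : ℂ :=
  Complex.exp (Real.pi * Complex.I * τ / 2 + 2 * Real.pi * Complex.I * z) *
    jacobiTheta₂ (2 * z + τ) (2 * τ)

theorem two_mul_im_pos {τ : ℂ} (hτ : 0 < τ.im) : 0 < (2 * τ).im := by
  simpa using hτ

theorem differentiable_theta1 {τ : ℂ} (hτ : 0 < τ.im) : Differentiable ℂ (theta1 τ) := by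
  intro z
  have h : DifferentiableAt ℂ (fun w => jacobiTheta₂ (w + (1 + τ) / 2) τ) z :=
    (differentiableAt_jacobiTheta₂_fst (z + (1 + τ) / 2) hτ).comp z
      (f := fun w => w + (1 + τ) / 2) (by fun_prop)
  unfold theta1
  fun_prop

theorem differentiable_thetaEven {τ : ℂ} (hτ : 0 < τ.im) : Differentiable ℂ (thetaEven τ) :=
  fun z => (differentiableAt_jacobiTheta₂_fst (2 * z) (two_mul_im_pos hτ)).comp z
    (f := fun w => 2 * w) (by fun_prop)

theorem differentiable_thetaOdd {τ : ℂ} (hτ : 0 < τ.im) : Differentiable ℂ (thetaOdd τ) := by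
  intro z
  have h : DifferentiableAt ℂ (fun w => jacobiTheta₂ (2 * w + τ) (2 * τ)) z :=
    (differentiableAt_jacobiTheta₂_fst (2 * z + τ) (two_mul_im_pos hτ)).comp z
      (f := fun w => 2 * w + τ) (by fun_prop)
  unfold thetaOdd
  fun_prop

theorem hasSum_theta1 {τ : ℂ} (hτ : 0 < τ.im) (z : ℂ) :
    HasSum (fun n : ℤ => -Complex.I * Complex.exp (Real.pi * Complex.I * τ / 4 +
      Real.pi * Complex.I * z) * jacobiTheta₂_term n (z + (1 + τ) / 2) τ) (theta1 τ z) :=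
  (hasSum_jacobiTheta₂_term _ hτ).mul_left _

theorem hasSum_thetaEven {τ : ℂ} (hτ : 0 < τ.im) (z : ℂ) :
    HasSum (fun n : ℤ => jacobiTheta₂_term n (2 * z) (2 * τ)) (thetaEven τ z) :=
  hasSum_jacobiTheta₂_term _ (two_mul_im_pos hτ)

theorem hasSum_thetaOdd {τ : ℂ} (hτ : 0 < τ.im) (z : ℂ) :
    HasSum (fun n : ℤ => Complex.exp (Real.pi * Complex.I * τ / 2 +
      2 * Real.pi * Complex.I * z) * jacobiTheta₂_term n (2 * z + τ) (2 * τ)) (thetaOdd τ z) :=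
  (hasSum_jacobiTheta₂_term _ (two_mul_im_pos hτ)).mul_left _

theorem HasSum.mul_prod_of_complex {ι κ : Type*} {f : ι → ℂ} {g : κ → ℂ} {a b : ℂ}
    (hf : HasSum f a) (hg : HasSum g b) :
    HasSum (fun x : ι × κ => f x.1 * g x.2) (a * b) :=
  hf.mul hg (summable_mul_of_summable_norm hf.summable.norm hg.summable.norm)

theorem neg_I_mul_exp_mul_exp (a b c d : ℂ) :
    -Complex.I * Complex.exp a * Complex.exp b * (-Complex.I * Complex.exp c * Complex.exp d) =
      -Complex.exp (a + b + c + d) := by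
  simp only [Complex.exp_add]
  linear_combination (Complex.exp a * Complex.exp b * Complex.exp c * Complex.exp d) * Complex.I_sq

theorem isCompl_range_int_sum_diff :
    IsCompl (Set.range fun x : ℤ × ℤ => (x.1 + x.2, x.1 - x.2 - 1))
      (Set.range fun x : ℤ × ℤ => (x.1 + x.2, x.1 - x.2)) := by
  rw [isCompl_iff, Set.disjoint_left, codisjoint_iff]
  refine ⟨?_, ?_⟩
  · rintro ⟨m, n⟩ ⟨⟨k, l⟩, h⟩ ⟨⟨k', l'⟩, h'⟩
    simp only [Prod.mk.injEq] at h h'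
    omega
  · refine Set.eq_univ_of_forall ?_
    rintro ⟨m, n⟩
    rcases Int.even_or_odd' (m + n) with ⟨c, hc | hc⟩
    · refine Or.inr ⟨(c, m - c), ?_⟩
      simp only [Prod.mk.injEq]
      omega
    · refine Or.inl ⟨(c + 1, m - c - 1), ?_⟩
      simp only [Prod.mk.injEq]
      omega

/-- A sum over `ℤ × ℤ` splits into the pairs with odd coordinate sum and those with even one. -/
theorem HasSum.of_sum_diff {f : ℤ × ℤ → ℂ} {a b : ℂ}
    (ha : HasSum (fun x : ℤ × ℤ => f (x.1 + x.2, x.1 - x.2 - 1)) a)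
    (hb : HasSum (fun x : ℤ × ℤ => f (x.1 + x.2, x.1 - x.2)) b) : HasSum f (a + b) := by
  have inj₁ : Function.Injective fun x : ℤ × ℤ => (x.1 + x.2, x.1 - x.2 - 1) := by
    rintro ⟨k, l⟩ ⟨k', l'⟩ h
    simp only [Prod.mk.injEq] at h ⊢
    omega
  have inj₂ : Function.Injective fun x : ℤ × ℤ => (x.1 + x.2, x.1 - x.2) := by
    rintro ⟨k, l⟩ ⟨k', l'⟩ h
    simp only [Prod.mk.injEq] at h ⊢
    omega
  exact HasSum.add_isCompl isCompl_range_int_sum_diff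
    (inj₁.hasSum_range_iff.mpr ha) (inj₂.hasSum_range_iff.mpr hb)

/-- The addition formula expressing `θ₁(x+y)θ₁(x-y)` through theta functions of modulus `2τ`. -/
theorem theta1_add_mul_theta1_sub {τ : ℂ} (hτ : 0 < τ.im) (x y : ℂ) :
    theta1 τ (x + y) * theta1 τ (x - y) =
      thetaEven τ x * thetaOdd τ y - thetaOdd τ x * thetaEven τ y := by
  have hprod := (hasSum_theta1 hτ (x + y)).mul_prod_of_complex (hasSum_theta1 hτ (x - y))
  have hEO := (hasSum_thetaEven hτ x).mul_prod_of_complex (hasSum_thetaOdd hτ y)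
  have hOE := ((hasSum_thetaOdd hτ x).mul_prod_of_complex (hasSum_thetaEven hτ y)).neg
  rw [sub_eq_add_neg (thetaEven τ x * thetaOdd τ y)]
  refine hprod.unique (HasSum.of_sum_diff ?_ ?_)
  · refine hEO.congr_fun fun q => ?_
    obtain ⟨k, l⟩ := q
    simp only [jacobiTheta₂_term, neg_I_mul_exp_mul_exp, ← Complex.exp_add, neg_eq_iff_eq_neg]
    rw [← Complex.exp_add_pi_mul_I]
    rw [Complex.exp_eq_exp_iff_exists_int]
    refine ⟨k - 1, ?_⟩
    push_cast
    ring
  · refine hOE.congr_fun fun q => ?_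
    obtain ⟨k, l⟩ := q
    simp only [jacobiTheta₂_term, neg_I_mul_exp_mul_exp, ← Complex.exp_add, neg_inj]
    rw [Complex.exp_eq_exp_iff_exists_int]
    refine ⟨k, ?_⟩
    push_cast
    ring

theorem deriv_deriv_add_mul_sub {f : ℂ → ℂ} (hf : Differentiable ℂ f) (x : ℂ) :
    deriv (deriv fun y => f (x + y) * f (x - y)) 0 =
      2 * (deriv (deriv f) x * f x - deriv f x ^ 2) := by
  have key : ∀ g : ℂ → ℂ, Differentiable ℂ g → ∀ y,
      HasDerivAt (fun y => g (x + y)) (deriv g (x + y)) y ∧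
        HasDerivAt (fun y => g (x - y)) (-deriv g (x - y)) y := fun g hg y =>
    ⟨by simpa using (hg (x + y)).hasDerivAt.comp_const_add x y,
      by simpa using (hg (x - y)).hasDerivAt.comp_const_sub x y⟩
  have hf' : Differentiable ℂ (deriv f) := hf.deriv
  have h1 : (deriv fun y => f (x + y) * f (x - y)) =
      fun y => deriv f (x + y) * f (x - y) + f (x + y) * -deriv f (x - y) :=
    funext fun y => ((key f hf y).1.mul (key f hf y).2).deriv
  rw [h1]
  refine (((key _ hf' 0).1.mul (key f hf 0).2).add
    ((key f hf 0).1.mul (key _ hf' 0).2.neg)).deriv.trans ?_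
  simp only [Pi.neg_apply, add_zero, sub_zero]
  ring

theorem deriv_deriv_const_mul_sub {f g : ℂ → ℂ} (hf : Differentiable ℂ f)
    (hg : Differentiable ℂ g) (a b z : ℂ) :
    deriv (deriv fun y => a * f y - b * g y) z =
      a * deriv (deriv f) z - b * deriv (deriv g) z := by
  have h1 : (deriv fun y => a * f y - b * g y) = fun y => a * deriv f y - b * deriv g y :=
    funext fun y => (((hf y).hasDerivAt.const_mul a).sub ((hg y).hasDerivAt.const_mul b)).deriv
  rw [h1]
  exact (((hf.deriv z).hasDerivAt.const_mul a).sub ((hg.deriv z).hasDerivAt.const_mul b)).deriv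

theorem two_mul_deriv_deriv_theta1_mul_sub_sq {τ : ℂ} (hτ : 0 < τ.im) (x : ℂ) :
    2 * (deriv (deriv (theta1 τ)) x * theta1 τ x - deriv (theta1 τ) x ^ 2) =
      thetaEven τ x * deriv (deriv (thetaOdd τ)) 0 -
        thetaOdd τ x * deriv (deriv (thetaEven τ)) 0 := by
  rw [← deriv_deriv_add_mul_sub (differentiable_theta1 hτ),
    ← deriv_deriv_const_mul_sub (differentiable_thetaOdd hτ) (differentiable_thetaEven hτ)]
  simp only [theta1_add_mul_theta1_sub hτ]

theorem theta1_neg {τ : ℂ} (hτ : 0 < τ.im) {p : ℂ} (hp : theta1 τ p ≠ 0) (z : ℂ) :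
    theta1 τ (-z) = -theta1 τ z := by
  have h₁ := theta1_add_mul_theta1_sub hτ ((p + z) / 2) ((p - z) / 2)
  have h₂ := theta1_add_mul_theta1_sub hτ ((p - z) / 2) ((p + z) / 2)
  rw [show (p + z) / 2 + (p - z) / 2 = p by ring,
    show (p + z) / 2 - (p - z) / 2 = z by ring] at h₁
  rw [show (p - z) / 2 + (p + z) / 2 = p by ring,
    show (p - z) / 2 - (p + z) / 2 = -z by ring] at h₂
  apply mul_left_cancel₀ hp
  linear_combination h₁ + h₂

/-- The three-term identity `θ₁(p+u)θ₁(p-u)θ₁'(0)² = θ₁(p)²θ₁(u)²(℘(p) - ℘(u))`. -/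
theorem theta1_mul_eq_wp_sub_wp {τ : ℂ} (hτ : 0 < τ.im) {p u : ℂ} (hp : theta1 τ p ≠ 0)
    (hu : theta1 τ u ≠ 0) :
    theta1 τ (p + u) * theta1 τ (p - u) * deriv (theta1 τ) 0 ^ 2 =
      theta1 τ p ^ 2 * theta1 τ u ^ 2 * (wp τ p - wp τ u) := by
  have h0 : theta1 τ 0 = 0 := by
    have := theta1_neg hτ hp 0
    rw [neg_zero] at this
    exact self_eq_neg.mp this
  have hsq : ∀ x, theta1 τ x ^ 2 =
      thetaEven τ x * thetaOdd τ 0 - thetaOdd τ x * thetaEven τ 0 := fun x => by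
    simpa [sq] using theta1_add_mul_theta1_sub hτ x 0
  have hW := two_mul_deriv_deriv_theta1_mul_sub_sq hτ
  have hW0 := hW 0
  rw [h0] at hW0
  have hmul : ∀ x, theta1 τ x ≠ 0 → theta1 τ x ^ 2 * wp τ x =
      deriv (deriv (theta1 τ)) x * theta1 τ x - deriv (theta1 τ) x ^ 2 := fun x hx => by
    unfold wp
    field_simp
  have hP := hmul p hp
  have hU := hmul u hu
  have e : theta1 τ p ^ 2 * theta1 τ u ^ 2 * (wp τ p - wp τ u) =
      theta1 τ u ^ 2 * (theta1 τ p ^ 2 * wp τ p) -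
        theta1 τ p ^ 2 * (theta1 τ u ^ 2 * wp τ u) := by ring
  rw [e, hP, hU, theta1_add_mul_theta1_sub hτ, hsq p, hsq u]
  set A := deriv (deriv (thetaEven τ)) 0
  set B := deriv (deriv (thetaOdd τ)) 0
  linear_combination (-1 / 2) * (thetaEven τ p * thetaOdd τ u - thetaOdd τ p * thetaEven τ u) * hW0
    - (1 / 2) * (thetaEven τ u * thetaOdd τ 0 - thetaOdd τ u * thetaEven τ 0) * hW p
    + (1 / 2) * (thetaEven τ p * thetaOdd τ 0 - thetaOdd τ p * thetaEven τ 0) * hW u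

theorem trace_conj_mul_conj {ι R : Type*} [Fintype ι] [DecidableEq ι] [CommRing R]
    {P Q : Matrix ι ι R} (hPQ : P * Q = 1) (X : Matrix ι ι R) :
    (Q * X * P * (Q * X * P)).trace = (X * X).trace := by
  rw [show Q * X * P * (Q * X * P) = Q * (X * (P * Q) * X * P) by simp only [Matrix.mul_assoc],
    Matrix.trace_mul_comm, hPQ, Matrix.mul_one, Matrix.mul_assoc, hPQ, Matrix.mul_one]

theorem trace_diagonal_add_sq {ι R : Type*} [Fintype ι] [DecidableEq ι] [CommRing R]
    (κ : ι → R) {F : Matrix ι ι R} (hF : ∀ a, F a a = 0) :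
    ((Matrix.diagonal κ + F) * (Matrix.diagonal κ + F)).trace =
      ∑ a, κ a ^ 2 + ∑ a, ∑ b, F a b * F b a := by
  rw [← Finset.sum_add_distrib]
  refine Finset.sum_congr rfl fun a _ => ?_
  simp only [Matrix.add_mul, Matrix.mul_add, Matrix.diag_apply, Matrix.add_apply,
    Matrix.diagonal_mul, Matrix.mul_diagonal, Matrix.diagonal_apply_eq, hF]
  rw [Matrix.mul_apply]
  ring

theorem PhiEll_eq_conj {τ : ℂ} {n : ℕ} {κ t : Fin n → ℂ} {C H : Matrix (Fin n) (Fin n) ℂ} {p : ℂ}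
    (hΘ : ThetaDiag τ n t p * (ThetaDiag τ n t p)⁻¹ = 1) :
    PhiEll τ n κ t C H p = H⁻¹ * (ThetaDiag τ n t p *
      (Matrix.diagonal κ + FMat τ n t C p) * (ThetaDiag τ n t p)⁻¹) * H := by
  have hcomm : ThetaDiag τ n t p * Matrix.diagonal κ = Matrix.diagonal κ * ThetaDiag τ n t p := by
    simp only [ThetaDiag, Matrix.diagonal_mul_diagonal, mul_comm]
  rw [PhiEll, Matrix.mul_add (ThetaDiag τ n t p),
    Matrix.add_mul _ _ (ThetaDiag τ n t p)⁻¹, hcomm,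
    Matrix.mul_assoc (Matrix.diagonal κ), hΘ,
    Matrix.mul_one]

theorem FMat_mul_FMat_swap {τ : ℂ} (hτ : 0 < τ.im) {n : ℕ} {t : Fin n → ℂ}
    (C : Matrix (Fin n) (Fin n) ℂ) {p : ℂ} (hp : theta1 τ p ≠ 0) {a b : Fin n} (hab : a ≠ b)
    (ht : theta1 τ (t a - t b) ≠ 0) :
    FMat τ n t C p a b * FMat τ n t C p b a =
      C a b * C b a * wp τ (t a - t b) - C a b * C b a * wp τ p := by
  have h := theta1_mul_eq_wp_sub_wp hτ hp ht
  have hneg : theta1 τ (t b - t a) = -theta1 τ (t a - t b) := by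
    rw [← theta1_neg hτ hp, neg_sub]
  simp only [FMat, Matrix.of_apply, if_neg hab, if_neg hab.symm, hneg]
  rw [show p + t a - t b = p + (t a - t b) by ring, show p + t b - t a = p - (t a - t b) by ring]
  field_simp
  linear_combination -(C a b * C b a) * h

/-- Evaluation of `Tr Φ(p)²` in terms of `℘` (the second logarithmic derivative of `θ₁`):
`Tr Φ(p)² = Σ κ_a² + Σ_{a≠b} C_{ab}C_{ba} ℘(t_a - t_b) - (Σ_{a≠b} C_{ab}C_{ba}) ℘(p)`. -/
theorem trace_PhiEll_sq_wp (τ : ℂ) (hτ : 0 < τ.im) (n : ℕ) (hn : 1 ≤ n)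
    (κ t : Fin n → ℂ) (C H : Matrix (Fin n) (Fin n) ℂ)
    (hC : ∀ a, C a a = 0) (hH : IsUnit H) (p : ℂ)
    (hp : theta1 τ p ≠ 0) (ht : ∀ a, theta1 τ (t a) ≠ 0)
    (hpt : ∀ a, theta1 τ (p - t a) ≠ 0)
    (htt : ∀ a b, a ≠ b → theta1 τ (t a - t b) ≠ 0) :
    (PhiEll τ n κ t C H p * PhiEll τ n κ t C H p).trace =
      (∑ a, κ a ^ 2) +
        (∑ a, ∑ b, (if a = b then 0 else C a b * C b a * wp τ (t a - t b))) -
        (∑ a, ∑ b, (if a = b then 0 else C a b * C b a)) * wp τ p := by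
  have hdet : IsUnit (ThetaDiag τ n t p).det := by
    rw [ThetaDiag, Matrix.det_diagonal, isUnit_iff_ne_zero]
    exact Finset.prod_ne_zero_iff.mpr fun a _ => div_ne_zero (hpt a) (ht a)
  rw [PhiEll_eq_conj (Matrix.mul_nonsing_inv _ hdet),
    trace_conj_mul_conj (Matrix.mul_nonsing_inv _ ((Matrix.isUnit_iff_isUnit_det H).mp hH)),
    trace_conj_mul_conj (Matrix.nonsing_inv_mul _ hdet),
    trace_diagonal_add_sq κ fun a => by simp [FMat], add_sub_assoc, Finset.sum_mul,
    ← Finset.sum_sub_distrib]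
  congr 1
  refine Finset.sum_congr rfl fun a _ => ?_
  rw [Finset.sum_mul, ← Finset.sum_sub_distrib]
  refine Finset.sum_congr rfl fun b _ => ?_
  split_ifs with hab
  · simp [FMat, hab]
  · exact FMat_mul_FMat_swap hτ C hp hab (htt a b hab)
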